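/- arXiv:1703.00606 — 2 statements merged into one kernel-verified Lean document; each statement's English description precedes it below -/
import Mathlib

section
/- Let G be a connected graph that is P6-free, diamond-free and K4-free, and suppose G contains an induced subgraph isomorphic to the bull. Then G is 6-colorable. -/
open SimpleGraph

/-- The disjoint union `P2 ∪ P3`, on 5 vertices: edges 01, 23, 34. -/
def p2p3 : SimpleGraph (Fin 5) :=
  SimpleGraph.fromEdgeSet {s(0, 1), s(2, 3), s(3, 4)}

/-- The diamond: `K4` minus the edge 02. -/
def diamond : SimpleGraph (Fin 4) :=
  SimpleGraph.fromEdgeSet {s(0, 1), s(1, 2), s(2, 3), s(0, 3), s(1, 3)}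

/-- The bull: vertices v1,...,v5 are 0,...,4; edges v1v2, v2v3, v3v4, v2v5, v3v5. -/
def bull : SimpleGraph (Fin 5) :=
  SimpleGraph.fromEdgeSet {s(0, 1), s(1, 2), s(2, 3), s(1, 4), s(2, 4)}

/-- `K4`, the complete graph on 4 vertices. -/
def K4 : SimpleGraph (Fin 4) := ⊤

/-- `G` contains no induced subgraph isomorphic to `H`
(graph embeddings are exactly induced copies). -/
def IndFree {α β : Type*} (H : SimpleGraph α) (G : SimpleGraph β) : Prop :=
  ¬ Nonempty (H ↪g G)

/-- Vertexwise form of freeness from the induced path on six vertices. -/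
def NoInducedP6 {V : Type*} (G : SimpleGraph V) : Prop :=
  ∀ ⦃a b c d e f : V⦄, G.Adj a b → G.Adj b c → G.Adj c d → G.Adj d e → G.Adj e f →
    ¬G.Adj a c → ¬G.Adj a d → ¬G.Adj a e → ¬G.Adj a f → ¬G.Adj b d → ¬G.Adj b e →
    ¬G.Adj b f → ¬G.Adj c e → ¬G.Adj c f → ¬G.Adj d f → False

/-- Every edge lies in at most one triangle. -/
def UniqueTriangles {V : Type*} (G : SimpleGraph V) : Prop :=
  ∀ ⦃u v a b : V⦄, G.Adj u v → G.Adj a u → G.Adj a v → G.Adj b u → G.Adj b v → a = b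

/-- The vertices `a, b, c, d, e` form, in this order, an induced cycle. -/
structure IsInducedC5 {V : Type*} (G : SimpleGraph V) (a b c d e : V) : Prop where
  ab : G.Adj a b
  bc : G.Adj b c
  cd : G.Adj c d
  de : G.Adj d e
  ea : G.Adj e a
  ac : ¬G.Adj a c
  bd : ¬G.Adj b d
  ce : ¬G.Adj c e
  da : ¬G.Adj d a
  eb : ¬G.Adj e b

theorem noInducedP6_of_indFree {V : Type*} {G : SimpleGraph V}
    (h : IndFree (pathGraph 6) G) : NoInducedP6 G := by
  intro a b c d e f hab hbc hcd hde hef hac had hae haf hbd hbe hbf hce hcf hdf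
  have key : ∀ i j : Fin 6,
      G.Adj (![a, b, c, d, e, f] i) (![a, b, c, d, e, f] j) ↔ (pathGraph 6).Adj i j := by
    intro i j
    fin_cases i <;> fin_cases j <;> simp [pathGraph_adj, G.adj_comm, *]
  refine h ⟨⟨⟨![a, b, c, d, e, f], fun i j hij => ?_⟩, key _ _⟩⟩
  have hn : ∀ k, (pathGraph 6).Adj i k ↔ (pathGraph 6).Adj j k := fun k => by
    rw [← key, ← key, hij]
  simp only [pathGraph_adj] at hn
  clear key hij
  revert i j
  decide

theorem uniqueTriangles_of_indFree {V : Type*} {G : SimpleGraph V}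
    (hD : IndFree diamond G) (hK : IndFree K4 G) : UniqueTriangles G := by
  intro u v a b huv hau hav hbu hbv
  by_contra hab
  have h1 := hau.ne
  have h2 := hav.ne
  have h3 := hbu.ne
  have h4 := hbv.ne
  have h5 := huv.ne
  have hinj : Function.Injective ![a, u, b, v] := by
    intro i j hij
    fin_cases i <;> fin_cases j <;> simp_all
  by_cases h : G.Adj a b
  · refine hK ⟨⟨⟨![a, u, b, v], hinj⟩, @fun i j => ?_⟩⟩
    fin_cases i <;> fin_cases j <;> simp [K4, *] <;> grind [G.adj_comm]
  · refine hD ⟨⟨⟨![a, u, b, v], hinj⟩, @fun i j => ?_⟩⟩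
    fin_cases i <;> fin_cases j <;> simp [diamond, *] <;> grind [G.adj_comm]

/-- A graph without an induced six-vertex path that is not bipartite contains a triangle or an
induced five-cycle. -/
theorem exists_triangle_or_c5 {V : Type*} {G : SimpleGraph V} (hP : NoInducedP6 G)
    (h2 : ¬G.Colorable 2) :
    (∃ a b c, G.Adj a b ∧ G.Adj b c ∧ G.Adj c a) ∨ ∃ a b c d e, IsInducedC5 G a b c d e := by
  classical
  rw [two_colorable_iff_forall_loop_even] at h2
  have hex : ∃ n, Odd n ∧ ∃ u, ∃ p : G.Walk u u, p.length = n := by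
    push Not at h2
    obtain ⟨u, p, hp⟩ := h2
    exact ⟨_, Nat.not_even_iff_odd.1 hp, u, p, rfl⟩
  obtain ⟨hodd, u, p, hp⟩ := Nat.find_spec hex
  have hmin : ∀ m, Odd m → (∃ u, ∃ p : G.Walk u u, p.length = m) → p.length ≤ m :=
    fun m hm hw => hp ▸ Nat.find_min' hex ⟨hm, hw⟩
  rw [← hp] at hodd
  set n := p.length with hn
  have hadj : ∀ i, i < n → G.Adj (p.getVert i) (p.getVert (i + 1)) :=
    fun i hi => p.adj_getVert_succ hi
  have hlast : p.getVert n = p.getVert 0 := by simp [hn]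
  have hchord : ∀ i j, i + 2 ≤ j → j + 2 ≤ n + i → j ≤ n →
      ¬G.Adj (p.getVert i) (p.getVert j) := by
    intro i j hij hji hj hA
    have hseg : ∃ q : G.Walk (p.getVert i) (p.getVert j), q.length = j - i := by
      refine ⟨((p.drop i).take (j - i)).copy rfl ?_, ?_⟩
      · rw [Walk.drop_getVert]; congr 1; omega
      · simp; omega
    obtain ⟨q, hq⟩ := hseg
    rcases Nat.even_or_odd (j - i) with he | ho
    · have := hmin (j - i + 1) he.add_one ⟨_, q.concat hA.symm, by simp [hq]⟩
      omega
    · have := hmin (n - j + 1 + i) (by grind) ⟨_, ((p.take i).concat hA).append (p.drop j), by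
        simp; omega⟩
      omega
  have hn1 : n ≠ 1 := fun h => (h ▸ hadj 0 (by omega)).ne (by simpa [h] using hlast.symm)
  rcases Nat.lt_or_ge n 7 with hlt | hge
  · have : n = 3 ∨ n = 5 := by grind
    rcases this with h | h <;> rw [h] at hlast hadj hchord
    · refine Or.inl ⟨_, _, _, hadj 0 (by omega), hadj 1 (by omega), ?_⟩
      have := hadj 2 (by omega)
      rwa [hlast] at this
    · refine Or.inr ⟨p.getVert 0, p.getVert 1, p.getVert 2, p.getVert 3, p.getVert 4,
        hadj 0 ?_, hadj 1 ?_, hadj 2 ?_, hadj 3 ?_, hlast ▸ hadj 4 ?_,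
        hchord 0 2 ?_ ?_ ?_, hchord 1 3 ?_ ?_ ?_, hchord 2 4 ?_ ?_ ?_,
        fun hc => hchord 0 3 ?_ ?_ ?_ hc.symm, fun hc => hchord 1 4 ?_ ?_ ?_ hc.symm⟩ <;> omega
  · refine (hP (hadj 0 ?_) (hadj 1 ?_) (hadj 2 ?_) (hadj 3 ?_) (hadj 4 ?_)
      (hchord 0 2 ?_ ?_ ?_) (hchord 0 3 ?_ ?_ ?_) (hchord 0 4 ?_ ?_ ?_) (hchord 0 5 ?_ ?_ ?_)
      (hchord 1 3 ?_ ?_ ?_) (hchord 1 4 ?_ ?_ ?_) (hchord 1 5 ?_ ?_ ?_) (hchord 2 4 ?_ ?_ ?_)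
      (hchord 2 5 ?_ ?_ ?_) (hchord 3 5 ?_ ?_ ?_)).elim <;> omega

theorem exists_triangle_or_c5_of_induce {V : Type*} {G : SimpleGraph V} (hP : NoInducedP6 G)
    {S : Set V} (h2 : ¬(G.induce S).Colorable 2) :
    (∃ a ∈ S, ∃ b ∈ S, ∃ c ∈ S, G.Adj a b ∧ G.Adj b c ∧ G.Adj c a) ∨
    ∃ a ∈ S, ∃ b ∈ S, ∃ c ∈ S, ∃ d ∈ S, ∃ e ∈ S, IsInducedC5 G a b c d e := by
  have hP' : NoInducedP6 (G.induce S) := fun _ _ _ _ _ _ => @hP _ _ _ _ _ _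
  rcases exists_triangle_or_c5 hP' h2 with ⟨a, b, c, h⟩ | ⟨a, b, c, d, e, h⟩
  · exact Or.inl ⟨a, a.2, b, b.2, c, c.2, h⟩
  · exact Or.inr ⟨a, a.2, b, b.2, c, c.2, d, d.2, e, e.2, h.ab, h.bc, h.cd, h.de, h.ea, h.ac,
      h.bd, h.ce, h.da, h.eb⟩

/-- A set in which every vertex has at most one neighbour induces a bipartite graph. -/
theorem induce_colorable_two_of_matching {V : Type*} {G : SimpleGraph V} (hP : NoInducedP6 G)
    {S : Set V} (hS : ∀ a ∈ S, ∀ b ∈ S, ∀ c ∈ S, G.Adj b a → G.Adj b c → a = c) :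
    (G.induce S).Colorable 2 := by
  by_contra h
  rcases exists_triangle_or_c5_of_induce hP h with
    ⟨a, ha, b, hb, c, hc, hab, hbc, hca⟩ | ⟨a, ha, b, hb, c, hc, d, _, e, _, h⟩
  · exact hca.ne (hS a ha b hb c hc hab.symm hbc).symm
  · have := hS a ha b hb c hc h.ab.symm h.bc
    subst this
    exact h.da h.cd.symm

theorem induce_neighborSet_colorable_two {V : Type*} {G : SimpleGraph V} (hP : NoInducedP6 G)
    (hT : UniqueTriangles G) (v : V) : (G.induce (G.neighborSet v)).Colorable 2 :=
  induce_colorable_two_of_matching hP fun _ ha _ hb _ hc hba hbc =>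
    hT hb (G.adj_symm ha) hba.symm (G.adj_symm hc) hbc.symm

theorem colorable_six_of_cover {V : Type*} {G : SimpleGraph V} {S T U : Set V}
    (hS : (G.induce S).Colorable 2) (hT : (G.induce T).Colorable 2)
    (hU : (G.induce U).Colorable 2) (hcov : ∀ v, v ∈ S ∨ v ∈ T ∨ v ∈ U) : G.Colorable 6 := by
  classical
  obtain ⟨f⟩ := hS
  obtain ⟨g⟩ := hT
  obtain ⟨h⟩ := hU
  let col : V → Fin 3 × Fin 2 := fun v =>
    if hs : v ∈ S then (0, f ⟨v, hs⟩) else if ht : v ∈ T then (1, g ⟨v, ht⟩)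
    else (2, h ⟨v, by have := hcov v; tauto⟩)
  have hval : ∀ u v, G.Adj u v → col u ≠ col v := by
    intro u v huv
    simp only [col]
    split_ifs <;> simp only [ne_eq, Prod.mk.injEq, not_and] <;>
      first
      | exact fun h01 => absurd h01 (by decide)
      | exact fun _ => f.valid huv
      | exact fun _ => g.valid huv
      | exact fun _ => h.valid huv
  have := (Coloring.mk col @hval).colorable
  simpa using this

/-- The vertex `v` is adjacent to none of `x`, `y`, `z`. -/
def Far {V : Type*} (G : SimpleGraph V) (x y z v : V) : Prop :=
  ¬G.Adj v x ∧ ¬G.Adj v y ∧ ¬G.Adj v z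

/-- The vertices `x`, `y`, `z` are pairwise adjacent. -/
structure IsTriangle {V : Type*} (G : SimpleGraph V) (x y z : V) : Prop where
  xy : G.Adj x y
  yz : G.Adj y z
  zx : G.Adj z x

/-- The vertex `k` is adjacent to `a`, or has a far neighbour adjacent to `a`. -/
def Touches {V : Type*} (G : SimpleGraph V) (x y z a k : V) : Prop :=
  G.Adj k a ∨ ∃ d, Far G x y z d ∧ G.Adj d a ∧ G.Adj d k

section Far

variable {V : Type*} {G : SimpleGraph V} {x y z : V}

theorem IsTriangle.rotate (h : IsTriangle G x y z) : IsTriangle G y z x := ⟨h.yz, h.zx, h.xy⟩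

theorem IsTriangle.swap (h : IsTriangle G x y z) : IsTriangle G x z y :=
  ⟨h.zx.symm, h.yz.symm, h.xy.symm⟩

theorem far_rotate {v : V} : Far G y z x v ↔ Far G x y z v := by
  unfold Far; tauto

theorem far_swap {v : V} : Far G x z y v ↔ Far G x y z v := by
  unfold Far; tauto

theorem not_far_cases {v : V} (h : ¬Far G x y z v) : G.Adj v x ∨ G.Adj v y ∨ G.Adj v z := by
  unfold Far at h; tauto

/-- A vertex adjacent to a far vertex and to `x` is adjacent to neither `y` nor `z`. -/
theorem IsTriangle.not_adj_of_far (hT : UniqueTriangles G) (h : IsTriangle G x y z) {a d : V}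
    (hd : Far G x y z d) (hda : G.Adj d a) (hax : G.Adj a x) : ¬G.Adj a y ∧ ¬G.Adj a z := by
  constructor
  · intro hay
    obtain rfl := hT h.xy hax hay h.zx h.yz.symm
    exact hd.2.2 hda
  · intro haz
    obtain rfl := hT h.zx haz hax h.yz h.xy.symm
    exact hd.2.1 hda

theorem IsTriangle.adj_of_far_path (hP : NoInducedP6 G) (hT : UniqueTriangles G)
    (h : IsTriangle G x y z) {a d k l : V} (ha : ¬Far G x y z a) (hd : Far G x y z d)
    (hk : Far G x y z k) (hl : Far G x y z l) (hda : G.Adj d a) (hdk : G.Adj d k)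
    (hkl : G.Adj k l) (hka : ¬G.Adj k a) (hla : ¬G.Adj l a) : G.Adj l d := by
  have key : ∀ {x y z : V}, IsTriangle G x y z → Far G x y z d → Far G x y z k →
      Far G x y z l → G.Adj a x → G.Adj l d := by
    intro x y z h hd hk hl hax
    by_contra hld
    exact hP hkl.symm hdk.symm hda hax h.xy hld hla hl.1 hl.2.1 hka hk.1 hk.2.1 hd.1 hd.2.1
      (h.not_adj_of_far hT hd hda hax).1
  rcases not_far_cases ha with hx | hy | hz
  · exact key h hd hk hl hx
  · exact key h.rotate (far_rotate.2 hd) (far_rotate.2 hk) (far_rotate.2 hl) hy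
  · exact key h.rotate.rotate (far_rotate.2 (far_rotate.2 hd)) (far_rotate.2 (far_rotate.2 hk))
      (far_rotate.2 (far_rotate.2 hl)) hz

theorem Touches.of_adj (hP : NoInducedP6 G) (hT : UniqueTriangles G) (h : IsTriangle G x y z)
    {a k l : V} (ha : ¬Far G x y z a) (hk : Far G x y z k) (hl : Far G x y z l)
    (ht : Touches G x y z a k) (hkl : G.Adj k l) : Touches G x y z a l := by
  by_cases hla : G.Adj l a
  · exact Or.inl hla
  by_cases hka : G.Adj k a
  · exact Or.inr ⟨k, hk, hka, hkl⟩
  rcases ht with ht | ⟨d, hd, hda, hdk⟩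
  · exact absurd ht hka
  · exact Or.inr ⟨d, hd, hda,
      (h.adj_of_far_path hP hT ha hd hk hl hda hdk hkl hka hla).symm⟩

theorem exists_touches_of_walk (hP : NoInducedP6 G) (hT : UniqueTriangles G)
    (h : IsTriangle G x y z) {k w : V} (p : G.Walk k w) (hk : Far G x y z k)
    (hw : ¬Far G x y z w) : ∃ a, ¬Far G x y z a ∧ Touches G x y z a k := by
  induction p with
  | nil => exact absurd hk hw
  | @cons u v w huv p ih =>
    by_cases hv : Far G x y z v
    · obtain ⟨a, ha, ht⟩ := ih hv hw
      exact ⟨a, ha, ht.of_adj hP hT h ha hv hk huv.symm⟩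
    · exact ⟨v, hv, Or.inl huv⟩

theorem exists_touches (hP : NoInducedP6 G) (hT : UniqueTriangles G) (h : IsTriangle G x y z)
    (hconn : G.Connected) {k : V} (hk : Far G x y z k) :
    ∃ a, ¬Far G x y z a ∧ Touches G x y z a k := by
  obtain ⟨p⟩ := hconn.preconnected k x
  exact exists_touches_of_walk hP hT h p hk fun hx => hx.2.1 h.xy

/-- The vertex `a` is not far and distinguishes the ends of the far edge `de`. -/
structure Splits (G : SimpleGraph V) (x y z a d e : V) : Prop where
  not_far : ¬Far G x y z a
  far_left : Far G x y z d
  far_right : Far G x y z e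
  adj : G.Adj d e
  adj_left : G.Adj d a
  not_adj_right : ¬G.Adj e a

theorem Touches.exists_splits (hT : UniqueTriangles G) {a k u v : V} (ha : ¬Far G x y z a)
    (hk : Far G x y z k) (hu : Far G x y z u) (hv : Far G x y z v) (hku : G.Adj k u)
    (hkv : G.Adj k v) (huv : u ≠ v) (ht : Touches G x y z a k) :
    ∃ d e, Splits G x y z a d e ∧ (k = d ∨ k = e) := by
  by_cases hka : G.Adj k a
  · by_cases hua : G.Adj u a
    · by_cases hva : G.Adj v a
      · exact absurd (hT hka hku.symm hua hkv.symm hva) huv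
      · exact ⟨k, v, ⟨ha, hk, hv, hkv, hka, hva⟩, Or.inl rfl⟩
    · exact ⟨k, u, ⟨ha, hk, hu, hku, hka, hua⟩, Or.inl rfl⟩
  · rcases ht with ht | ⟨d, hd, hda, hdk⟩
    · exact absurd ht hka
    · exact ⟨d, k, ⟨ha, hd, hk, hdk, hda, hka⟩, Or.inr rfl⟩

theorem Splits.adj_or_adj (hP : NoInducedP6 G) (hT : UniqueTriangles G)
    (h : IsTriangle G x y z) {a d e a' d' e' : V} (hs : Splits G x y z a d e)
    (hs' : Splits G x y z a' d' e') (hd'a : ¬G.Adj d' a) (he'a : ¬G.Adj e' a)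
    (hdd : ¬G.Adj d d') (hde : ¬G.Adj d e') (hed : ¬G.Adj e d') (hee : ¬G.Adj e e') :
    G.Adj d a' ∨ G.Adj e a' := by
  by_contra! hcon
  obtain ⟨hda', hea'⟩ := hcon
  have hda := hs.adj_left
  have hd'a' := hs'.adj_left
  have hna : ¬G.Adj a a' := fun haa => hP hs.adj.symm hda haa hd'a'.symm hs'.adj
    hs.not_adj_right hea' hed hee hda' hdd hde (fun hc => hd'a hc.symm)
    (fun hc => he'a hc.symm) (fun hc => hs'.not_adj_right hc.symm)
  have same : ∀ {x y z : V}, Far G x y z d → Far G x y z e → Far G x y z d' →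
      G.Adj a x → ¬G.Adj a' x := fun fd fe fd' hax ha'x =>
    hP hs.adj.symm hda hax ha'x.symm hd'a'.symm hs.not_adj_right fe.1 hea' hed fd.1 hda' hdd
      hna (fun hc => hd'a hc.symm) (fun hc => fd'.1 hc.symm)
  have other : ∀ {x y z : V}, IsTriangle G x y z → Far G x y z d → Far G x y z e →
      G.Adj a x → ¬G.Adj a' x → ¬G.Adj a' y := fun h fd fe hax ha'x ha'y =>
    hP hs.adj.symm hda hax h.xy ha'y.symm hs.not_adj_right fe.1 fe.2.1 hea' fd.1 fd.2.1 hda'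
      (h.not_adj_of_far hT fd hda hax).1 hna (fun hc => ha'x hc.symm)
  have key : ∀ {x y z : V}, IsTriangle G x y z → Far G x y z d → Far G x y z e →
      Far G x y z d' → ¬Far G x y z a' → ¬G.Adj a x := by
    intro x y z h fd fe fd' hf' hax
    have hx := same fd fe fd' hax
    rcases not_far_cases hf' with hc | hc | hc
    · exact hx hc
    · exact other h fd fe hax hx hc
    · exact other h.swap (far_swap.2 fd) (far_swap.2 fe) hax hx hc
  have fd := hs.far_left
  have fe := hs.far_right
  have fd' := hs'.far_left
  have hf' := hs'.not_far
  rcases not_far_cases hs.not_far with hx | hx | hx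
  · exact key h fd fe fd' hf' hx
  · rw [← far_rotate] at fd fe fd' hf'
    exact key h.rotate fd fe fd' hf' hx
  · rw [← far_rotate, ← far_rotate] at fd fe fd' hf'
    exact key h.rotate.rotate fd fe fd' hf' hx

theorem exists_splits_of_maximal [Finite V] (hP : NoInducedP6 G) (hT : UniqueTriangles G)
    (h : IsTriangle G x y z) (hconn : G.Connected) (hex : ∃ a d e, Splits G x y z a d e) :
    ∃ a d e, Splits G x y z a d e ∧ ∀ u v w, Far G x y z u → Far G x y z v → Far G x y z w →
      ¬G.Adj u a → ¬G.Adj v a → ¬G.Adj w a → G.Adj v u → G.Adj v w → u = w := by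
  let W : Set V := {k | Far G x y z k ∧
    ∃ u v, Far G x y z u ∧ Far G x y z v ∧ G.Adj k u ∧ G.Adj k v ∧ u ≠ v}
  let t : V → Set V := fun a => {k | k ∈ W ∧ Touches G x y z a k}
  have hsplit : ∀ {a k}, ¬Far G x y z a → k ∈ t a →
      ∃ d e, Splits G x y z a d e ∧ (k = d ∨ k = e) := by
    rintro a k ha ⟨⟨hk, u, v, hu, hv, hku, hkv, huv⟩, ht⟩
    exact ht.exists_splits hT ha hk hu hv hku hkv huv
  by_cases hW : ∃ k, k ∈ W
  · obtain ⟨k₀, hk₀⟩ := hW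
    obtain ⟨a₀, ha₀, ht₀⟩ := exists_touches hP hT h hconn hk₀.1
    obtain ⟨a, ⟨ha, k, hk⟩, hmax⟩ := Set.exists_max_image {a | ¬Far G x y z a ∧ (t a).Nonempty}
      (fun a => (t a).ncard) (Set.toFinite _) ⟨a₀, ha₀, k₀, hk₀, ht₀⟩
    obtain ⟨d, e, hs, -⟩ := hsplit ha hk
    refine ⟨a, d, e, hs, fun u v w hu hv hw hua hva hwa hvu hvw => ?_⟩
    by_contra huw
    have hvt : ¬Touches G x y z a v := by
      rintro (hc | ⟨c, hc, hca, hcv⟩)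
      · exact hva hc
      · exact huw (hT hcv (h.adj_of_far_path hP hT ha hc hv hu hca hcv hvu hva hua) hvu.symm
          (h.adj_of_far_path hP hT ha hc hv hw hca hcv hvw hva hwa) hvw.symm)
    have hvW : v ∈ W := ⟨hv, u, w, hu, hw, hvu, hvw, huw⟩
    obtain ⟨a', ha', hv'⟩ := exists_touches hP hT h hconn hv
    obtain ⟨d', e', hs', hve⟩ := hsplit ha' ⟨hvW, hv'⟩
    have hd' : ¬Touches G x y z a d' := by
      rcases hve with rfl | rfl
      · exact hvt
      · exact fun hc => hvt (hc.of_adj hP hT h ha hs'.far_left hs'.far_right hs'.adj)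
    have he' : ¬Touches G x y z a e' := fun hc =>
      hd' (hc.of_adj hP hT h ha hs'.far_right hs'.far_left hs'.adj.symm)
    have hsub : t a ⊆ t a' := by
      intro k hk
      refine ⟨hk.1, ?_⟩
      obtain ⟨d, e, hs, hkd⟩ := hsplit ha hk
      have hd : Touches G x y z a d := Or.inl hs.adj_left
      have he : Touches G x y z a e := Or.inr ⟨d, hs.far_left, hs.adj_left, hs.adj⟩
      have := hs.adj_or_adj hP hT h hs' (fun hc => hd' (Or.inl hc)) (fun hc => he' (Or.inl hc))
        (fun hc => hd' (hd.of_adj hP hT h ha hs.far_left hs'.far_left hc))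
        (fun hc => he' (hd.of_adj hP hT h ha hs.far_left hs'.far_right hc))
        (fun hc => hd' (he.of_adj hP hT h ha hs.far_right hs'.far_left hc))
        (fun hc => he' (he.of_adj hP hT h ha hs.far_right hs'.far_right hc))
      rcases hkd with rfl | rfl <;> rcases this with hc | hc
      · exact Or.inl hc
      · exact Or.inr ⟨e, hs.far_right, hc, hs.adj.symm⟩
      · exact Or.inr ⟨d, hs.far_left, hc, hs.adj⟩
      · exact Or.inl hc
    have hlt : (t a).ncard < (t a').ncard :=
      Set.ncard_lt_ncard ⟨hsub, fun hc => hvt (hc ⟨hvW, hv'⟩).2⟩ (Set.toFinite _)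
    exact absurd (hmax a' ⟨ha', v, hvW, hv'⟩) (not_le.2 hlt)
  · obtain ⟨a, d, e, hs⟩ := hex
    refine ⟨a, d, e, hs, fun u v w hu hv hw _ _ _ hvu hvw => ?_⟩
    by_contra huw
    exact hW ⟨v, hv, u, w, hu, hw, hvu, hvw, huw⟩

end Far

section FiveCycle

variable {V : Type*} {G : SimpleGraph V} {x y z : V}

theorem IsInducedC5.rotate {a b c d e : V} (h : IsInducedC5 G a b c d e) :
    IsInducedC5 G b c d e a :=
  ⟨h.bc, h.cd, h.de, h.ea, h.ab, h.bd, h.ce, h.da, h.eb, h.ac⟩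

theorem IsInducedC5.reverse {a b c d e : V} (h : IsInducedC5 G a b c d e) :
    IsInducedC5 G a e d c b :=
  ⟨h.ea.symm, h.de.symm, h.cd.symm, h.bc.symm, h.ab.symm, fun hc => h.da hc.symm,
    fun hc => h.ce hc.symm, fun hc => h.bd hc.symm, fun hc => h.ac hc.symm,
    fun hc => h.eb hc.symm⟩

theorem IsInducedC5.adj_or_adj (hP : NoInducedP6 G) {p q w : V} (hpq : G.Adj p q)
    (hwq : G.Adj w q) (hwp : ¬G.Adj w p) {S : Set V} (hS : ∀ v ∈ S, ¬G.Adj v p ∧ ¬G.Adj v q)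
    {a b c d e : V} (h : IsInducedC5 G a b c d e) (ha : a ∈ S) (hb : b ∈ S) (hc : c ∈ S)
    (hwa : G.Adj w a) : G.Adj w b ∨ G.Adj w c := by
  by_contra! hcon
  exact hP hpq hwq.symm hwa h.ab h.bc (fun hc => hwp hc.symm) (fun hc => (hS _ ha).1 hc.symm)
    (fun hc => (hS _ hb).1 hc.symm) (fun h => (hS _ hc).1 h.symm)
    (fun hc => (hS _ ha).2 hc.symm) (fun hc => (hS _ hb).2 hc.symm)
    (fun h => (hS _ hc).2 h.symm) hcon.1 hcon.2 h.ac

/-- The neighbours of `w` on an induced five-cycle form an edge together with the vertex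
opposite to it. -/
theorem IsInducedC5.attach_cases (hP : NoInducedP6 G) (hT : UniqueTriangles G) {p q w : V}
    (hpq : G.Adj p q) (hwq : G.Adj w q) (hwp : ¬G.Adj w p) {S : Set V}
    (hS : ∀ v ∈ S, ¬G.Adj v p ∧ ¬G.Adj v q)
    {a b c d e : V} (h : IsInducedC5 G a b c d e) (ha : a ∈ S) (hb : b ∈ S) (hc : c ∈ S)
    (hd : d ∈ S) (he : e ∈ S)
    (hw : G.Adj w a ∨ G.Adj w b ∨ G.Adj w c ∨ G.Adj w d ∨ G.Adj w e) :
    (G.Adj w a ∧ G.Adj w b ∧ ¬G.Adj w c ∧ G.Adj w d ∧ ¬G.Adj w e) ∨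
    (G.Adj w b ∧ G.Adj w c ∧ ¬G.Adj w d ∧ G.Adj w e ∧ ¬G.Adj w a) ∨
    (G.Adj w c ∧ G.Adj w d ∧ ¬G.Adj w e ∧ G.Adj w a ∧ ¬G.Adj w b) ∨
    (G.Adj w d ∧ G.Adj w e ∧ ¬G.Adj w a ∧ G.Adj w b ∧ ¬G.Adj w c) ∨
    (G.Adj w e ∧ G.Adj w a ∧ ¬G.Adj w b ∧ G.Adj w c ∧ ¬G.Adj w d) := by
  have tri : ∀ {a b c d e : V}, IsInducedC5 G a b c d e →
      ¬(G.Adj w a ∧ G.Adj w b ∧ G.Adj w c) := fun {a b c d e} h ⟨h1, h2, h3⟩ => by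
    obtain rfl := hT h2 h1.symm h.ab h3.symm h.bc.symm
    exact h.da h.cd.symm
  have f1 := h.adj_or_adj hP hpq hwq hwp hS ha hb hc
  have f2 := h.rotate.adj_or_adj hP hpq hwq hwp hS hb hc hd
  have f3 := h.rotate.rotate.adj_or_adj hP hpq hwq hwp hS hc hd he
  have f4 := h.rotate.rotate.rotate.adj_or_adj hP hpq hwq hwp hS hd he ha
  have f5 := h.rotate.rotate.rotate.rotate.adj_or_adj hP hpq hwq hwp hS he ha hb
  have g1 := h.reverse.adj_or_adj hP hpq hwq hwp hS ha he hd
  have g2 := h.rotate.reverse.adj_or_adj hP hpq hwq hwp hS hb ha he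
  have g3 := h.rotate.rotate.reverse.adj_or_adj hP hpq hwq hwp hS hc hb ha
  have g4 := h.rotate.rotate.rotate.reverse.adj_or_adj hP hpq hwq hwp hS hd hc hb
  have g5 := h.rotate.rotate.rotate.rotate.reverse.adj_or_adj hP hpq hwq hwp hS he hd hc
  have t1 := tri h
  have t2 := tri h.rotate
  have t3 := tri h.rotate.rotate
  have t4 := tri h.rotate.rotate.rotate
  have t5 := tri h.rotate.rotate.rotate.rotate
  clear tri hS h
  grind

theorem IsInducedC5.exists_attached (hP : NoInducedP6 G) (hT : UniqueTriangles G) {p q w : V}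
    (hpq : G.Adj p q) (hwq : G.Adj w q) (hwp : ¬G.Adj w p) {S : Set V}
    (hS : ∀ v ∈ S, ¬G.Adj v p ∧ ¬G.Adj v q)
    {a b c d e : V} (h : IsInducedC5 G a b c d e) (ha : a ∈ S) (hb : b ∈ S) (hc : c ∈ S)
    (hd : d ∈ S) (he : e ∈ S)
    (hw : G.Adj w a ∨ G.Adj w b ∨ G.Adj w c ∨ G.Adj w d ∨ G.Adj w e) :
    ∃ a ∈ S, ∃ b ∈ S, ∃ c ∈ S, ∃ d ∈ S, ∃ e ∈ S, IsInducedC5 G a b c d e ∧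
      G.Adj w a ∧ G.Adj w b ∧ ¬G.Adj w c ∧ G.Adj w d ∧ ¬G.Adj w e := by
  rcases h.attach_cases hP hT hpq hwq hwp hS ha hb hc hd he hw with hw | hw | hw | hw | hw
  · exact ⟨a, ha, b, hb, c, hc, d, hd, e, he, h, hw⟩
  · exact ⟨b, hb, c, hc, d, hd, e, he, a, ha, h.rotate, hw⟩
  · exact ⟨c, hc, d, hd, e, he, a, ha, b, hb, h.rotate.rotate, hw⟩
  · exact ⟨d, hd, e, he, a, ha, b, hb, c, hc, h.rotate.rotate.rotate, hw⟩
  · exact ⟨e, he, a, ha, b, hb, c, hc, d, hd, h.rotate.rotate.rotate.rotate, hw⟩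

end FiveCycle

section Split

variable {V : Type*} {G : SimpleGraph V} {x y z a d e : V}

theorem IsTriangle.adj_or_adj_of_splits (hP : NoInducedP6 G) (hT : UniqueTriangles G)
    (h : IsTriangle G x y z) (hs : Splits G x y z a d e) (hax : G.Adj a x) {b : V}
    (hb : ¬G.Adj b a ∧ ¬G.Adj b x) (hby : G.Adj b y) : G.Adj b d ∨ G.Adj b e := by
  by_contra! hcon
  have hd := hs.far_left
  have he := hs.far_right
  exact hP hs.adj.symm hs.adj_left hax h.xy hby.symm hs.not_adj_right he.1 he.2.1
    (fun hc => hcon.2 hc.symm) hd.1 hd.2.1 (fun hc => hcon.1 hc.symm)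
    (h.not_adj_of_far hT hd hs.adj_left hax).1 (fun hc => hb.1 hc.symm)
    (fun hc => hb.2 hc.symm)

theorem IsTriangle.adj_far_of_adj (hP : NoInducedP6 G) (hT : UniqueTriangles G)
    (h : IsTriangle G x y z) (hax : G.Adj a x) (hda : G.Adj d a) (hd : Far G x y z d)
    {b f : V} (hb : ¬G.Adj b a ∧ ¬G.Adj b x) (hbz : ¬G.Adj b z) (hf : ¬G.Adj f a ∧ ¬G.Adj f x)
    (hfz : ¬G.Adj f z) (hfb : G.Adj f b) (hbd : G.Adj b d) : G.Adj f d := by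
  by_contra hfd
  exact hP hfb hbd hda hax h.zx.symm hfd hf.1 hf.2 hfz hb.1 hb.2 hbz hd.1 hd.2.2
    (h.not_adj_of_far hT hd hda hax).2

theorem IsTriangle.not_adj_of_not_adj (hT : UniqueTriangles G) (h : IsTriangle G x y z)
    (hax : G.Adj a x) {b : V} (hb : ¬G.Adj b a ∧ ¬G.Adj b x) (hby : G.Adj b y) :
    ¬G.Adj b z := by
  intro hbz
  obtain rfl := hT h.yz hby hbz h.xy h.zx.symm
  exact hb.1 hax.symm

theorem IsTriangle.no_triangle (hP : NoInducedP6 G) (hT : UniqueTriangles G)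
    (h : IsTriangle G x y z) (hax : G.Adj a x) (hda : G.Adj d a) (hd : Far G x y z d)
    {b u v : V} (hb : ¬G.Adj b a ∧ ¬G.Adj b x) (hu : ¬G.Adj u a ∧ ¬G.Adj u x)
    (hv : ¬G.Adj v a ∧ ¬G.Adj v x) (hbu : G.Adj b u) (huv : G.Adj u v) (hvb : G.Adj v b) :
    ¬G.Adj b y := by
  intro hby
  obtain ⟨hay, haz⟩ := h.not_adj_of_far hT hd hda hax
  have hbz := h.not_adj_of_not_adj hT hax hb hby
  have far : ∀ {u v : V}, ¬G.Adj u a ∧ ¬G.Adj u x → ¬G.Adj v a ∧ ¬G.Adj v x → G.Adj b u →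
      G.Adj u v → G.Adj v b → ¬G.Adj b d → G.Adj u d := by
    intro u v hu hv hbu huv hvb hbd
    by_contra hud
    have huy : ¬G.Adj u y := fun huy => by
      obtain rfl := hT hbu hby.symm huy.symm hvb huv.symm
      exact hv.2 h.xy.symm
    exact hP hbu.symm hby h.xy.symm hax.symm hda.symm huy hu.2 hu.1 hud hb.2 hb.1 hbd
      (fun hc => hay hc.symm) (fun hc => hd.2.1 hc.symm) (fun hc => hd.1 hc.symm)
  by_cases hbd : G.Adj b d
  · have near : ∀ {u v : V}, ¬G.Adj u a ∧ ¬G.Adj u x → ¬G.Adj v a ∧ ¬G.Adj v x → G.Adj b u →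
        G.Adj u v → G.Adj v b → G.Adj u z := by
      intro u v hu hv hbu huv hvb
      by_contra huz
      have hud : ¬G.Adj u d := fun hud => by
        obtain rfl := hT hbu hbd.symm hud.symm hvb huv.symm
        exact hv.1 hda
      exact hP hbu.symm hbd hda hax h.zx.symm hud hu.1 hu.2 huz hb.1 hb.2 hbz hd.1 hd.2.2 haz
    obtain rfl := hT huv hbu hvb.symm (near hu hv hbu huv hvb).symm
      (near hv hu hvb.symm huv.symm hbu.symm).symm
    exact hb.2 h.zx
  · obtain rfl := hT huv hbu hvb.symm (far hu hv hbu huv hvb hbd).symm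
      (far hv hu hvb.symm huv.symm hbu.symm hbd).symm
    exact hb.1 hda

theorem IsTriangle.no_c5 (hP : NoInducedP6 G) (hT : UniqueTriangles G)
    (h : IsTriangle G x y z) (hs : Splits G x y z a d e) (hax : G.Adj a x) {S : Set V}
    (hS : ∀ v ∈ S, ¬G.Adj v a ∧ ¬G.Adj v x) {v₀ v₁ v₂ v₃ v₄ : V} (h₀ : v₀ ∈ S) (h₁ : v₁ ∈ S)
    (h₂ : v₂ ∈ S) (h₃ : v₃ ∈ S) (h₄ : v₄ ∈ S) (hC : IsInducedC5 G v₀ v₁ v₂ v₃ v₄) :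
    ¬(G.Adj y v₀ ∨ G.Adj y v₁ ∨ G.Adj y v₂ ∨ G.Adj y v₃ ∨ G.Adj y v₄) := by
  intro hy
  have hd := hs.far_left
  have hda := hs.adj_left
  obtain ⟨hay, haz⟩ := h.not_adj_of_far hT hd hda hax
  obtain ⟨v₀, h₀, v₁, h₁, v₂, h₂, v₃, h₃, v₄, h₄, hC, hy₀, hy₁, hy₂, hy₃, hy₄⟩ :=
    hC.exists_attached hP hT hax h.xy.symm (fun hc => hay hc.symm) hS h₀ h₁ h₂ h₃ h₄ hy
  replace h₀ := hS _ h₀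
  replace h₁ := hS _ h₁
  replace h₂ := hS _ h₂
  replace h₃ := hS _ h₃
  replace h₄ := hS _ h₄
  have hz₀ := h.not_adj_of_not_adj hT hax h₀ hy₀.symm
  have hz₁ := h.not_adj_of_not_adj hT hax h₁ hy₁.symm
  have hz₂ : ¬G.Adj v₂ z := fun hc =>
    hP hax h.zx.symm hc.symm hC.bc.symm hC.ab.symm haz (fun hc => h₂.1 hc.symm)
      (fun hc => h₁.1 hc.symm) (fun hc => h₀.1 hc.symm) (fun hc => h₂.2 hc.symm)
      (fun hc => h₁.2 hc.symm) (fun hc => h₀.2 hc.symm) (fun hc => hz₁ hc.symm)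
      (fun hc => hz₀ hc.symm) (fun hc => hC.ac hc.symm)
  have hz₄ : ¬G.Adj v₄ z := fun hc =>
    hP hax h.zx.symm hc.symm hC.ea hC.ab haz (fun hc => h₄.1 hc.symm)
      (fun hc => h₀.1 hc.symm) (fun hc => h₁.1 hc.symm) (fun hc => h₄.2 hc.symm)
      (fun hc => h₀.2 hc.symm) (fun hc => h₁.2 hc.symm) (fun hc => hz₀ hc.symm)
      (fun hc => hz₁ hc.symm) hC.eb
  have step : ∀ {p q r : V}, ¬G.Adj p a ∧ ¬G.Adj p x → ¬G.Adj q a ∧ ¬G.Adj q x →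
      ¬G.Adj r a ∧ ¬G.Adj r x → ¬G.Adj q z → ¬G.Adj r z → G.Adj y p → G.Adj y q →
      ¬G.Adj y r → G.Adj p q → G.Adj r q → ¬G.Adj p r → ¬G.Adj q d := by
    intro p q r hp hq hr hqz hrz hyp hyq hyr hpq hrq hpr hqd
    have hrd := h.adj_far_of_adj hP hT hax hda hd hq hqz hr hrz hrq hqd
    have hr' : Far G x y z r := ⟨hr.2, fun hc => hyr hc.symm, hrz⟩
    have hsr : Splits G x y z a d r := ⟨hs.not_far, hd, hr', hrd.symm, hda, hr.1⟩
    rcases h.adj_or_adj_of_splits hP hT hsr hax hp hyp.symm with hc | hc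
    · obtain rfl := hT hpq hc.symm hqd.symm hyp hyq
      exact hay hda.symm
    · exact hpr hc
  have hd₁ := step h₀ h₁ h₂ hz₁ hz₂ hy₀ hy₁ hy₂ hC.ab hC.bc.symm hC.ac
  have hd₀ := step h₁ h₀ h₄ hz₀ hz₄ hy₁ hy₀ hy₄ hC.ab.symm hC.ea (fun hc => hC.eb hc.symm)
  have he₀ := (h.adj_or_adj_of_splits hP hT hs hax h₀ hy₀.symm).resolve_left hd₀
  have he₁ := (h.adj_or_adj_of_splits hP hT hs hax h₁ hy₁.symm).resolve_left hd₁
  obtain rfl := hT hC.ab he₀.symm he₁.symm hy₀ hy₁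
  exact hs.far_right.1 h.xy.symm

theorem Splits.swap (hs : Splits G x y z a d e) : Splits G x z y a d e :=
  ⟨fun hc => hs.not_far (far_swap.1 hc), far_swap.2 hs.far_left, far_swap.2 hs.far_right,
    hs.adj, hs.adj_left, hs.not_adj_right⟩

theorem Splits.rotate (hs : Splits G x y z a d e) : Splits G y z x a d e :=
  ⟨fun hc => hs.not_far (far_rotate.1 hc), far_rotate.2 hs.far_left, far_rotate.2 hs.far_right,
    hs.adj, hs.adj_left, hs.not_adj_right⟩

theorem IsTriangle.colorable_six_of_splits_of_adj (hP : NoInducedP6 G) (hT : UniqueTriangles G)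
    (h : IsTriangle G x y z) (hs : Splits G x y z a d e) (hax : G.Adj a x)
    (hpath : ∀ u v w, Far G x y z u → Far G x y z v → Far G x y z w →
      ¬G.Adj u a → ¬G.Adj v a → ¬G.Adj w a → G.Adj v u → G.Adj v w → u = w) :
    G.Colorable 6 := by
  refine colorable_six_of_cover (U := {v | ¬G.Adj v a ∧ ¬G.Adj v x})
    (induce_neighborSet_colorable_two hP hT a) (induce_neighborSet_colorable_two hP hT x) ?_ ?_
  · by_contra hcon
    have hda := hs.adj_left
    have hd := hs.far_left
    rcases exists_triangle_or_c5_of_induce hP hcon with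
      ⟨u, hu, v, hv, w, hw, huv, hvw, hwu⟩ | ⟨v₀, h₀, v₁, h₁, v₂, h₂, v₃, h₃, v₄, h₄, hC⟩
    · have far : ∀ {u v w : V}, ¬G.Adj u a ∧ ¬G.Adj u x → ¬G.Adj v a ∧ ¬G.Adj v x →
          ¬G.Adj w a ∧ ¬G.Adj w x → G.Adj u v → G.Adj v w → G.Adj w u → Far G x y z u :=
        fun hu hv hw huv hvw hwu =>
          ⟨hu.2, h.no_triangle hP hT hax hda hd hu hv hw huv hvw hwu,
            h.swap.no_triangle hP hT hax hda (far_swap.2 hd) hu hv hw huv hvw hwu⟩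
      exact hwu.ne (hpath u v w (far hu hv hw huv hvw hwu) (far hv hw hu hvw hwu huv)
        (far hw hu hv hwu huv hvw) hu.1 hv.1 hw.1 huv.symm hvw).symm
    · have hy := h.no_c5 hP hT hs hax (fun _ hv => hv) h₀ h₁ h₂ h₃ h₄ hC
      have hz := h.swap.no_c5 hP hT hs.swap hax (fun _ hv => hv) h₀ h₁ h₂ h₃ h₄ hC
      simp only [not_or, G.adj_comm y, G.adj_comm z] at hy hz
      obtain rfl := hpath v₀ v₁ v₂ ⟨h₀.2, hy.1, hz.1⟩ ⟨h₁.2, hy.2.1, hz.2.1⟩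
        ⟨h₂.2, hy.2.2.1, hz.2.2.1⟩ h₀.1 h₁.1 h₂.1 hC.ab.symm hC.bc
      exact hC.da hC.cd.symm
  · intro v
    simp only [mem_neighborSet, Set.mem_ofPred_eq, G.adj_comm v]
    tauto

theorem IsTriangle.colorable_six_of_splits [Finite V] (hP : NoInducedP6 G)
    (hT : UniqueTriangles G) (h : IsTriangle G x y z) (hconn : G.Connected)
    (hex : ∃ a d e, Splits G x y z a d e) : G.Colorable 6 := by
  obtain ⟨a, d, e, hs, hpath⟩ := exists_splits_of_maximal hP hT h hconn hex
  rcases not_far_cases hs.not_far with hx | hx | hx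
  · exact h.colorable_six_of_splits_of_adj hP hT hs hx hpath
  · simp only [← far_rotate (x := x)] at hpath
    exact h.rotate.colorable_six_of_splits_of_adj hP hT hs.rotate hx hpath
  · simp only [← far_rotate (x := x)] at hpath
    simp only [← far_rotate (x := y)] at hpath
    exact h.rotate.rotate.colorable_six_of_splits_of_adj hP hT hs.rotate.rotate hx hpath

end Split

section NoSplit

variable {V : Type*} {G : SimpleGraph V} {x y z : V}

/-- The vertex `v` is far and has a far neighbour. -/
def FarMatched (G : SimpleGraph V) (x y z v : V) : Prop :=
  Far G x y z v ∧ ∃ w, Far G x y z w ∧ G.Adj v w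

theorem farMatched_rotate {v : V} : FarMatched G y z x v ↔ FarMatched G x y z v := by
  simp only [FarMatched, far_rotate]

/-- The vertices that are far without far neighbours, or adjacent to `z` only. -/
def residualSet (G : SimpleGraph V) (x y z : V) : Set V :=
  {v | ¬G.Adj v x ∧ ¬G.Adj v y ∧ ¬FarMatched G x y z v}

theorem exists_adj_of_far (hP : NoInducedP6 G) (hT : UniqueTriangles G) (h : IsTriangle G x y z)
    (hconn : G.Connected) (hns : ∀ a d e, ¬Splits G x y z a d e) {k : V}
    (hk : Far G x y z k) : ∃ a, ¬Far G x y z a ∧ G.Adj k a := by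
  obtain ⟨a, ha, hka | ⟨d, hd, hda, hdk⟩⟩ := exists_touches hP hT h hconn hk
  · exact ⟨a, ha, hka⟩
  · exact ⟨a, ha, by_contra fun hka => hns a d k ⟨ha, hd, hk, hdk, hda, hka⟩⟩

theorem far_adj_unique (hP : NoInducedP6 G) (hT : UniqueTriangles G) (h : IsTriangle G x y z)
    (hconn : G.Connected) (hns : ∀ a d e, ¬Splits G x y z a d e) {u k v : V}
    (hu : Far G x y z u) (hk : Far G x y z k) (hv : Far G x y z v) (hku : G.Adj k u)
    (hkv : G.Adj k v) : u = v := by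
  obtain ⟨a, ha, hka⟩ := exists_adj_of_far hP hT h hconn hns hk
  refine hT hka hku.symm ?_ hkv.symm ?_
  · exact by_contra fun hua => hns a k u ⟨ha, hk, hu, hku, hka, hua⟩
  · exact by_contra fun hva => hns a k v ⟨ha, hk, hv, hkv, hka, hva⟩

theorem induce_adj_or_far_colorable_two (hP : NoInducedP6 G) (hT : UniqueTriangles G)
    (h : IsTriangle G x y z) (hconn : G.Connected) (hns : ∀ a d e, ¬Splits G x y z a d e) {p : V}
    {M : Set V} (hM : ∀ v ∈ M, Far G x y z v ∧ ∀ w, G.Adj v w → ¬G.Adj w p) :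
    (G.induce {v | G.Adj v p ∨ v ∈ M}).Colorable 2 := by
  refine induce_colorable_two_of_matching hP ?_
  rintro a (ha | ha) b (hb | hb) c (hc | hc) hba hbc
  · exact hT hb hba.symm ha hbc.symm hc
  · exact absurd hb ((hM c hc).2 b hbc.symm)
  · exact absurd ha ((hM b hb).2 a hba)
  · exact absurd ha ((hM b hb).2 a hba)
  · exact absurd hb ((hM a ha).2 b hba.symm)
  · exact absurd hb ((hM a ha).2 b hba.symm)
  · exact absurd hc ((hM b hb).2 c hbc)
  · exact far_adj_unique hP hT h hconn hns (hM a ha).1 (hM b hb).1 (hM c hc).1 hba hbc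

theorem IsTriangle.colorable_six_of_residualSet (hP : NoInducedP6 G) (hT : UniqueTriangles G)
    (h : IsTriangle G x y z) (hconn : G.Connected) (hns : ∀ a d e, ¬Splits G x y z a d e)
    (hres : (G.induce (residualSet G x y z)).Colorable 2) : G.Colorable 6 := by
  refine colorable_six_of_cover
    (induce_adj_or_far_colorable_two (p := x)
      (M := {v | FarMatched G x y z v ∧ ∀ w, G.Adj v w → ¬G.Adj w x}) hP hT h hconn hns ?_)
    (induce_adj_or_far_colorable_two (p := y)
      (M := {v | FarMatched G x y z v ∧ ∃ w, G.Adj v w ∧ G.Adj w x}) hP hT h hconn hns ?_)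
    hres ?_
  · exact fun v hv => ⟨hv.1.1, hv.2⟩
  · rintro v ⟨⟨hv, f, hf, hvf⟩, a, hva, hax⟩
    refine ⟨hv, fun b hvb hby => ?_⟩
    have hfa : G.Adj f a := by_contra fun hfa =>
      hns a v f ⟨fun hc => hc.1 hax, hv, hf, hvf, hva, hfa⟩
    have hfb : G.Adj f b := by_contra fun hfb =>
      hns b v f ⟨fun hc => hc.2.1 hby, hv, hf, hvf, hvb, hfb⟩
    obtain rfl := hT hvf hva.symm hfa.symm hvb.symm hfb.symm
    exact (h.not_adj_of_far hT hv hva hax).1 hby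
  · intro v
    by_cases hv : FarMatched G x y z v
    · by_cases hw : ∃ w, G.Adj v w ∧ G.Adj w x
      · exact Or.inr (Or.inl (Or.inr ⟨hv, hw⟩))
      · push Not at hw
        exact Or.inl (Or.inr ⟨hv, hw⟩)
    · by_cases hx : G.Adj v x
      · exact Or.inl (Or.inl hx)
      by_cases hy : G.Adj v y
      · exact Or.inr (Or.inl (Or.inl hy))
      exact Or.inr (Or.inr ⟨hx, hy, hv⟩)

theorem adj_or_adj_of_mem_residualSet {u v : V} (hu : u ∈ residualSet G x y z)
    (hv : v ∈ residualSet G x y z) (huv : G.Adj u v) : G.Adj u z ∨ G.Adj v z := by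
  by_contra! hcon
  exact hu.2.2 ⟨⟨hu.1, hu.2.1, hcon.1⟩, v, ⟨hv.1, hv.2.1, hcon.2⟩, huv⟩

/-- A residual set that is not bipartite contains an induced five-cycle with exactly two far
vertices. -/
theorem IsTriangle.exists_c5_of_residualSet (hP : NoInducedP6 G) (hT : UniqueTriangles G)
    (h : IsTriangle G x y z) (hres : ¬(G.induce (residualSet G x y z)).Colorable 2) :
    ∃ a ∈ residualSet G x y z, ∃ b ∈ residualSet G x y z, ∃ c ∈ residualSet G x y z,
      ∃ d ∈ residualSet G x y z, ∃ e ∈ residualSet G x y z, IsInducedC5 G a b c d e ∧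
        ¬G.Adj a z ∧ ¬G.Adj c z ∧ G.Adj d z ∧ G.Adj e z := by
  rcases exists_triangle_or_c5_of_induce hP hres with
    ⟨u, hu, v, hv, w, hw, huv, hvw, hwu⟩ | ⟨a, ha, b, hb, c, hc, d, hd, e, he, hC⟩
  · have key : ∀ {u v w : V}, w ∈ residualSet G x y z → G.Adj u v → G.Adj v w → G.Adj w u →
        G.Adj u z → ¬G.Adj v z := by
      intro u v w hw huv hvw hwu huz hvz
      obtain rfl := hT huv hwu hvw.symm huz.symm hvz.symm
      exact hw.1 h.zx
    have h₁ := key hw huv hvw hwu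
    have h₂ := key hu hvw hwu huv
    have h₃ := key hv hwu huv hvw
    have e₁ := adj_or_adj_of_mem_residualSet hu hv huv
    have e₂ := adj_or_adj_of_mem_residualSet hv hw hvw
    have e₃ := adj_or_adj_of_mem_residualSet hw hu hwu
    tauto
  · have key : ∀ {a b c d e : V}, IsInducedC5 G a b c d e → G.Adj a z → G.Adj b z →
        ¬G.Adj c z := by
      intro a b c d e hC haz hbz hcz
      obtain rfl := hT hbz hC.ab haz hC.bc.symm hcz
      exact hC.da hC.cd.symm
    have e₁ := adj_or_adj_of_mem_residualSet ha hb hC.ab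
    have e₂ := adj_or_adj_of_mem_residualSet hb hc hC.bc
    have e₃ := adj_or_adj_of_mem_residualSet hc hd hC.cd
    have e₄ := adj_or_adj_of_mem_residualSet hd he hC.de
    have e₅ := adj_or_adj_of_mem_residualSet he ha hC.ea
    have h₁ := key hC
    have h₂ := key hC.rotate
    have h₃ := key hC.rotate.rotate
    have h₄ := key hC.rotate.rotate.rotate
    have h₅ := key hC.rotate.rotate.rotate.rotate
    have cases : (¬G.Adj a z ∧ ¬G.Adj c z ∧ G.Adj d z ∧ G.Adj e z) ∨
        (¬G.Adj b z ∧ ¬G.Adj d z ∧ G.Adj e z ∧ G.Adj a z) ∨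
        (¬G.Adj c z ∧ ¬G.Adj e z ∧ G.Adj a z ∧ G.Adj b z) ∨
        (¬G.Adj d z ∧ ¬G.Adj a z ∧ G.Adj b z ∧ G.Adj c z) ∨
        (¬G.Adj e z ∧ ¬G.Adj b z ∧ G.Adj c z ∧ G.Adj d z) := by
      clear key
      grind
    rcases cases with hz | hz | hz | hz | hz
    · exact ⟨a, ha, b, hb, c, hc, d, hd, e, he, hC, hz⟩
    · exact ⟨b, hb, c, hc, d, hd, e, he, a, ha, hC.rotate, hz⟩
    · exact ⟨c, hc, d, hd, e, he, a, ha, b, hb, hC.rotate.rotate, hz⟩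
    · exact ⟨d, hd, e, he, a, ha, b, hb, c, hc, hC.rotate.rotate.rotate, hz⟩
    · exact ⟨e, he, a, ha, b, hb, c, hc, d, hd, hC.rotate.rotate.rotate.rotate, hz⟩

theorem IsTriangle.residualSet_colorable_two_or (hP : NoInducedP6 G) (hT : UniqueTriangles G)
    (h : IsTriangle G x y z) : (G.induce (residualSet G x y z)).Colorable 2 ∨
      (G.induce (residualSet G y z x)).Colorable 2 := by
  by_contra! hcon
  obtain ⟨a, ha, b, hb, c, hc, d, hd, e, he, hC, haz, hcz, hdz, hez⟩ :=
    h.exists_c5_of_residualSet hP hT hcon.1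
  obtain ⟨a', ha', b', -, c', hc', d', hd', e', he', hC', hax', hcx', hdx', hex'⟩ :=
    h.rotate.exists_c5_of_residualSet hP hT hcon.2
  have faa : Far G x y z a := ⟨ha.1, ha.2.1, haz⟩
  have fac : Far G x y z c := ⟨hc.1, hc.2.1, hcz⟩
  have faa' : Far G x y z a' := ⟨hax', ha'.1, ha'.2.1⟩
  have fac' : Far G x y z c' := ⟨hcx', hc'.1, hc'.2.1⟩
  have nonadj : ∀ {w f : V}, w ∈ residualSet G y z x → G.Adj w x → Far G x y z f →
      f ∈ residualSet G y z x → G.Adj f w →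
      G.Adj w a ∨ G.Adj w b ∨ G.Adj w c ∨ G.Adj w d ∨ G.Adj w e := by
    intro w f hw hwx ff hf hfw
    by_contra! hn
    obtain ⟨hna, hnb, hnc, hnd, hne⟩ := hn
    have far_not_adj : ∀ {v : V}, Far G x y z v → ¬G.Adj f v := fun {v} hv hfv =>
      hf.2.2 (farMatched_rotate.2 ⟨ff, v, hv, hfv⟩)
    have hfe : G.Adj f e := by
      by_contra hfe
      exact hP hfw hwx h.zx.symm hez.symm hC.ea ff.1 ff.2.2 hfe (far_not_adj faa) hw.2.1 hne hna
        (fun hc => he.1 hc.symm) (fun hc => ha.1 hc.symm) (fun hc => haz hc.symm)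
    have hfd : G.Adj f d := by
      by_contra hfd
      exact hP hfw hwx h.zx.symm hdz.symm hC.cd.symm ff.1 ff.2.2 hfd (far_not_adj fac) hw.2.1
        hnd hnc (fun hc => hd.1 hc.symm) (fun h => hc.1 h.symm) (fun hc => hcz hc.symm)
    obtain rfl := hT hC.de hfd hfe hdz.symm hez.symm
    exact ff.1 h.zx
  have hS : ∀ v ∈ residualSet G x y z, ¬G.Adj v y ∧ ¬G.Adj v x := fun v hv => ⟨hv.2.1, hv.1⟩
  have hd'K := hC.attach_cases hP hT h.xy.symm hdx' hd'.1 hS ha hb hc hd he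
    (nonadj hd' hdx' fac' hc' hC'.cd)
  have he'K := hC.attach_cases hP hT h.xy.symm hex' he'.1 hS ha hb hc hd he
    (nonadj he' hex' faa' ha' hC'.ea.symm)
  have disjoint : ∀ v ∈ residualSet G x y z, G.Adj d' v → ¬G.Adj e' v := by
    intro v hv hdv hev
    obtain rfl := hT hC'.de hdv.symm hev.symm hdx'.symm hex'.symm
    exact hv.2.1 h.xy
  have ga := disjoint a ha
  have gb := disjoint b hb
  have gc := disjoint c hc
  have gd := disjoint d hd
  have ge := disjoint e he
  clear nonadj disjoint hS
  grind

end NoSplit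

/-- A connected graph with a triangle that has no induced six-vertex path and whose edges lie in
at most one triangle each is 6-colorable. -/
theorem IsTriangle.colorable_six {V : Type*} [Finite V] {G : SimpleGraph V} {x y z : V}
    (h : IsTriangle G x y z) (hconn : G.Connected) (hP : NoInducedP6 G)
    (hT : UniqueTriangles G) : G.Colorable 6 := by
  by_cases hex : ∃ a d e, Splits G x y z a d e
  · exact h.colorable_six_of_splits hP hT hconn hex
  · push Not at hex
    rcases h.residualSet_colorable_two_or hP hT with hres | hres
    · exact h.colorable_six_of_residualSet hP hT hconn hex hres
    · exact h.rotate.colorable_six_of_residualSet hP hT hconn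
        (fun a d e hs => hex a d e hs.rotate.rotate) hres

/-- Every connected (P6, diamond, K4)-free graph containing an induced bull
is 6-colorable. -/
theorem stmt4 {V : Type*} [Fintype V] (G : SimpleGraph V)
    (hconn : G.Connected)
    (hP : IndFree (pathGraph 6) G) (hD : IndFree diamond G) (hK : IndFree K4 G)
    (hbull : Nonempty (bull ↪g G)) :
    G.Colorable 6 := by
  obtain ⟨f⟩ := hbull
  have h : IsTriangle G (f 1) (f 2) (f 4) := by
    constructor <;> rw [f.map_adj_iff] <;> simp [bull]
  exact h.colorable_six hconn (noInducedP6_of_indFree hP) (uniqueTriangles_of_indFree hD hK)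
end

section
/- Let G be a connected graph that is P6-free, diamond-free, bull-free and K4-free, and suppose G contains an induced 5-cycle C. Then every vertex of G is at distance at most 2 from C; that is, for every vertex y of G there is a vertex of C at graph distance at most 2 from y. -/
open SimpleGraph

/-- A map that preserves and reflects strict-order adjacency and is injective on increasing pairs
is an induced copy. -/
theorem nonempty_embedding_of_lt {n : ℕ} {V : Type*} {H : SimpleGraph (Fin n)} {G : SimpleGraph V}
    (f : Fin n → V)
    (h : ∀ i j, i < j → f i ≠ f j ∧ (G.Adj (f i) (f j) ↔ H.Adj i j)) :
    Nonempty (H ↪g G) := by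
  have hf : Function.Injective f := fun i j hij => by
    rcases lt_trichotomy i j with hlt | heq | hgt
    · exact absurd hij (h i j hlt).1
    · exact heq
    · exact absurd hij.symm (h j i hgt).1
  refine ⟨⟨⟨f, hf⟩, ?_⟩⟩
  intro i j
  change G.Adj (f i) (f j) ↔ H.Adj i j
  rcases lt_trichotomy i j with hlt | rfl | hgt
  · exact (h i j hlt).2
  · simp
  · rw [G.adj_comm, H.adj_comm]
    exact (h j i hgt).2

theorem IndFree.not_path {V : Type*} {G : SimpleGraph V} (hP : IndFree (pathGraph 6) G)
    {a b c d e f : V} (hab : G.Adj a b) (hbc : G.Adj b c) (hcd : G.Adj c d) (hde : G.Adj d e)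
    (hef : G.Adj e f) (hac : ¬ G.Adj a c) (had : ¬ G.Adj a d) (hae : ¬ G.Adj a e)
    (haf : ¬ G.Adj a f) (hbd : ¬ G.Adj b d) (hbe : ¬ G.Adj b e) (hbf : ¬ G.Adj b f)
    (hce : ¬ G.Adj c e) (hcf : ¬ G.Adj c f) (hdf : ¬ G.Adj d f) : False := by
  refine hP (nonempty_embedding_of_lt ![a, b, c, d, e, f] fun i j hij => ⟨?_, ?_⟩)
  · fin_cases i <;> fin_cases j <;> simp at hij ⊢ <;>
      rintro rfl <;> simp_all [G.adj_comm]
  · fin_cases i <;> fin_cases j <;> simp_all [pathGraph_adj]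

theorem IndFree.not_diamond {V : Type*} {G : SimpleGraph V} (hD : IndFree diamond G)
    {a b c d : V} (hab : G.Adj a b) (hbc : G.Adj b c) (hcd : G.Adj c d) (had : G.Adj a d)
    (hbd : G.Adj b d) (hac : ¬ G.Adj a c) (hne : a ≠ c) : False := by
  refine hD (nonempty_embedding_of_lt ![a, b, c, d] fun i j hij => ⟨?_, ?_⟩)
  · fin_cases i <;> fin_cases j <;> simp_all [G.ne_of_adj]
  · fin_cases i <;> fin_cases j <;> simp_all [diamond]

theorem IndFree.not_bull {V : Type*} {G : SimpleGraph V} (hB : IndFree bull G)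
    {a b c d e : V} (hab : G.Adj a b) (hbc : G.Adj b c) (hcd : G.Adj c d) (hbe : G.Adj b e)
    (hce : G.Adj c e) (hac : ¬ G.Adj a c) (had : ¬ G.Adj a d) (hae : ¬ G.Adj a e)
    (hbd : ¬ G.Adj b d) (hde : ¬ G.Adj d e) : False := by
  refine hB (nonempty_embedding_of_lt ![a, b, c, d, e] fun i j hij => ⟨?_, ?_⟩)
  · fin_cases i <;> fin_cases j <;> simp at hij ⊢ <;>
      rintro rfl <;> simp_all [G.adj_comm]
  · fin_cases i <;> fin_cases j <;> simp_all [bull]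

/-- A nonempty subset of the 5-cycle contains three consecutive vertices, or has a maximal run of
length exactly two, or misses two vertices following one of its elements. -/
theorem cyclic_pattern_five (p : Fin 5 → Bool) (hp : ∃ i, p i) :
    ∃ i, (p i ∧ ¬ p (i + 1) ∧ ¬ p (i + 2)) ∨ (p i ∧ p (i + 1) ∧ p (i + 2)) ∨
      (¬ p i ∧ p (i + 1) ∧ p (i + 2) ∧ ¬ p (i + 3)) := by
  revert p
  decide

/-- In a connected (P6, diamond, bull, K4)-free graph containing an induced
5-cycle v0...v4, every vertex is at distance at most 2 from the cycle. -/
theorem stmt14 {V : Type*} [Fintype V] (G : SimpleGraph V)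
    (hconn : G.Connected)
    (hP : IndFree (pathGraph 6) G) (hD : IndFree diamond G)
    (hB : IndFree bull G) (hK : IndFree K4 G)
    (v : Fin 5 → V) (hinj : Function.Injective v)
    (hC : ∀ i j : Fin 5, G.Adj (v i) (v j) ↔ (j = i + 1 ∨ i = j + 1)) :
    ∀ y : V, ∃ i : Fin 5, G.dist y (v i) ≤ 2 := by
  have step : ∀ b z, G.Adj z b → (∃ i, G.dist b (v i) ≤ 2) → ∃ i, G.dist z (v i) ≤ 2 := by
    rintro b z hzb ⟨k, hk⟩
    by_contra! hz
    have hzv : ∀ i, ¬ G.Adj z (v i) := fun i h => by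
      have := dist_le h.toWalk
      have := hz i
      simp at *
      omega
    have no_two : ∀ c i, G.Adj z c → ¬ G.Adj c (v i) := fun c i h h' => by
      have := dist_le (Walk.cons h h'.toWalk)
      have := hz i
      simp at *
      omega
    have hbv : ∀ i, ¬ G.Adj b (v i) := fun i => no_two b i hzb
    obtain ⟨a, hba, hak⟩ : ∃ a, G.Adj b a ∧ G.Adj a (v k) := by
      obtain ⟨w, hw⟩ : ∃ w : G.Walk b (v k), w.length ≤ 2 := by
        obtain ⟨w, hw⟩ := hconn.exists_walk_length_eq_dist b (v k)
        exact ⟨w, hw ▸ hk⟩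
      have hzk := hzv k
      have hbk := hbv k
      clear * - w hw hzk hbk hzb
      generalize v k = x at *
      match w, hw with
      | .nil, _ => exact absurd hzb hzk
      | .cons h .nil, _ => exact absurd h hbk
      | .cons h (.cons h' .nil), _ => exact ⟨_, h, h'⟩
      | .cons _ (.cons _ (.cons _ _)), hw => simp at hw
    have hza : ¬ G.Adj z a := fun h => no_two a k h hak
    classical
    obtain ⟨i, h⟩ := cyclic_pattern_five (fun i => decide (G.Adj a (v i))) ⟨k, by simpa using hak⟩
    simp only [decide_eq_true_eq] at h
    have adj₁ : G.Adj (v i) (v (i + 1)) := (hC _ _).2 (by grind)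
    have adj₂ : G.Adj (v (i + 1)) (v (i + 2)) := (hC _ _).2 (by grind)
    have adj₃ : G.Adj (v (i + 2)) (v (i + 3)) := (hC _ _).2 (by grind)
    have nadj₁ : ¬ G.Adj (v i) (v (i + 2)) := by rw [hC]; clear * -; decide +revert
    have nadj₂ : ¬ G.Adj (v i) (v (i + 3)) := by rw [hC]; clear * -; decide +revert
    have nadj₃ : ¬ G.Adj (v (i + 1)) (v (i + 3)) := by rw [hC]; clear * -; decide +revert
    rcases h with ⟨h₀, h₁, h₂⟩ | ⟨h₀, h₁, h₂⟩ | ⟨h₀, h₁, h₂, h₃⟩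
    · exact hP.not_path hzb hba h₀ adj₁ adj₂ hza (hzv _) (hzv _) (hzv _) (hbv _) (hbv _) (hbv _)
        h₁ h₂ nadj₁
    · refine hD.not_diamond adj₁ adj₂ h₂.symm h₀.symm h₁.symm nadj₁ fun h => ?_
      have := hinj h
      revert this
      clear * -
      decide +revert
    · exact hB.not_bull adj₁ adj₂ adj₃ h₁.symm h₂.symm nadj₁ nadj₂ (fun h => h₀ h.symm) nadj₃
        (fun h => h₃ h.symm)
  intro y
  obtain ⟨w⟩ := hconn.preconnected y (v 0)
  generalize hx : v 0 = x at w
  induction w with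
  | nil => exact ⟨0, by simp [hx]⟩
  | cons h _ ih => exact step _ _ h (ih hx)
end
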